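/- arXiv:1501.03104 — 8 statements merged into one kernel-verified Lean document; each statement's English description precedes it below -/
import Mathlib

section
/- Let V be a finite type with 16 elements and f : V → ℕ a labeling that is a bijection onto {1, …, 16}. Let h₁, h₂, h₃, h₄ ⊆ V each have cardinality 6 and each have label sum equal to M. Suppose h₁ ∩ h₄ = ∅, let c = V \ (h₁ ∪ h₄) and a = h₂ ∩ h₃, and suppose |a| = 2, a ∩ c = ∅, and c ⊆ h₂ ∪ h₃. Then 40 ≤ M ≤ 62. -/
/-- Distinct integer labels that are at least `m` have sum at least that of the smallest
integers from `m` on. -/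
theorem Finset.sum_range_le_sum_of_injective {V : Type*} {f : V → ℤ}
    (hf : Function.Injective f) {m : ℤ} {s : Finset V} (hm : ∀ v ∈ s, m ≤ f v) :
    ∑ i ∈ Finset.range s.card, (m + i) ≤ ∑ v ∈ s, f v := by
  have h := Finset.sum_range_le_sum (s := s.map ⟨f, hf⟩) (c := m) (by simpa using hm)
  simpa only [Finset.card_map, Finset.sum_map, Function.Embedding.coeFn_mk] using h

/-- Distinct integer labels that are at most `m` have sum at most that of the largest
integers up to `m`. -/
theorem Finset.sum_le_sum_range_of_injective {V : Type*} {f : V → ℤ}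
    (hf : Function.Injective f) {m : ℤ} {s : Finset V} (hm : ∀ v ∈ s, f v ≤ m) :
    ∑ v ∈ s, f v ≤ ∑ i ∈ Finset.range s.card, (m - i) := by
  have h := Finset.sum_le_sum_range (s := s.map ⟨f, hf⟩) (c := m) (by simpa using hm)
  simpa only [Finset.card_map, Finset.sum_map, Function.Embedding.coeFn_mk] using h


/-- The magic constant of a 2 by 2 diamond-shaped HTP on 16 vertices lies
between 40 and 62. -/
theorem htp_diamond22_magic_bound (V : Type*) [Fintype V] [DecidableEq V]
    (hcard : Fintype.card V = 16)
    (f : V → ℕ) (hinj : Function.Injective f)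
    (himg : Finset.image f Finset.univ = Finset.Icc 1 16)
    (h₁ h₂ h₃ h₄ : Finset V) (M : ℕ)
    (hc₁ : h₁.card = 6) (hc₂ : h₂.card = 6) (hc₃ : h₃.card = 6) (hc₄ : h₄.card = 6)
    (hs₁ : ∑ v ∈ h₁, f v = M) (hs₂ : ∑ v ∈ h₂, f v = M)
    (hs₃ : ∑ v ∈ h₃, f v = M) (hs₄ : ∑ v ∈ h₄, f v = M)
    (hdisj : h₁ ∩ h₄ = ∅)
    (c : Finset V) (hc : c = Finset.univ \ (h₁ ∪ h₄))
    (a : Finset V) (ha : a = h₂ ∩ h₃)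
    (hacard : a.card = 2) (hac : a ∩ c = ∅) (hcsub : c ⊆ h₂ ∪ h₃) :
    40 ≤ M ∧ M ≤ 62 := by
  have hmem (v : V) : f v ∈ Finset.Icc 1 16 :=
    himg ▸ Finset.mem_image_of_mem f (Finset.mem_univ v)
  have hg : Function.Injective (fun v => (f v : ℤ)) := Nat.cast_injective.comp hinj
  have hlo (v : V) : (1 : ℤ) ≤ f v := by exact_mod_cast (Finset.mem_Icc.mp (hmem v)).1
  have hhi (v : V) : (f v : ℤ) ≤ 16 := by exact_mod_cast (Finset.mem_Icc.mp (hmem v)).2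
  have htotal : ∑ v, f v = 136 := by
    have h := Finset.sum_image (f := fun n : ℕ => n) (s := Finset.univ) hinj.injOn
    rw [himg] at h
    exact h.symm
  have hd : Disjoint h₁ h₄ := Finset.disjoint_iff_inter_eq_empty.mpr hdisj
  have hcardc : c.card + (h₁ ∪ h₄).card = 16 := by
    rw [hc, Finset.card_sdiff_add_card_eq_card (Finset.subset_univ _), Finset.card_univ, hcard]
  have hsumc : ∑ v ∈ c, f v + ∑ v ∈ h₁ ∪ h₄, f v = 136 := by
    rw [hc, Finset.sum_sdiff (Finset.subset_univ _), htotal]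
  rw [Finset.card_union_of_disjoint hd] at hcardc
  rw [Finset.sum_union hd] at hsumc
  have hcardu := Finset.card_union_add_card_inter h₂ h₃
  have hsumu := Finset.sum_union_inter (s₁ := h₂) (s₂ := h₃) (f := f)
  rw [← ha] at hcardu hsumu
  have hcardb := Finset.card_sdiff_add_card_eq_card hcsub
  have hsumb := Finset.sum_sdiff (f := f) hcsub
  have hb : ((h₂ ∪ h₃) \ c).card = 6 := by omega
  have hloa := Finset.sum_range_le_sum_of_injective hg (s := a) fun v _ => hlo v
  have hhia := Finset.sum_le_sum_range_of_injective hg (s := a) fun v _ => hhi v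
  have hlob := Finset.sum_range_le_sum_of_injective hg (s := (h₂ ∪ h₃) \ c) fun v _ => hlo v
  have hhib := Finset.sum_le_sum_range_of_injective hg (s := (h₂ ∪ h₃) \ c) fun v _ => hhi v
  rw [hacard, ← Nat.cast_sum] at hloa hhia
  rw [hb, ← Nat.cast_sum] at hlob hhib
  norm_num [Finset.sum_range_succ, -Nat.cast_sum] at hloa hhia hlob hhib
  omega
end

section
/- Let T and D be disjoint subsets of {1, …, 30} with |T| = 2 and |D| = 14, and suppose there exist distinct elements x, y ∈ D with x + y ≤ 15. Then 2·(∑_{v ∈ T} v) + (∑_{v ∈ D} v) ≤ 403, and hence 465 + 2·(∑_{v ∈ T} v) + (∑_{v ∈ D} v) ≤ 868. -/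
/-- For every threshold `c`, the sum of a finite set `S` of naturals is at most `c * #S` plus the
total excess over `c` of any finite set containing `S`. -/
theorem Finset.sum_id_le_mul_card_add_sum_tsub {S U : Finset ℕ} (h : S ⊆ U) (c : ℕ) :
    ∑ v ∈ S, v ≤ c * S.card + ∑ v ∈ U, (v - c) :=
  calc ∑ v ∈ S, v ≤ ∑ v ∈ S, (c + (v - c)) := Finset.sum_le_sum fun _ _ => le_add_tsub
    _ = c * S.card + ∑ v ∈ S, (v - c) := by
      rw [Finset.sum_add_distrib, Finset.sum_const, smul_eq_mul, mul_comm]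
    _ ≤ c * S.card + ∑ v ∈ U, (v - c) := by gcongr


/-- Bound used in the 3 by 3 diamond-shaped HTP: if `T` and `D` are disjoint
subsets of `{1, …, 30}` with `|T| = 2`, `|D| = 14`, and `D` contains two distinct
elements summing to at most 15, then `2·(∑ T) + (∑ D) ≤ 403`, hence
`465 + 2·(∑ T) + (∑ D) ≤ 868`. -/
theorem htp_diamond33_TD_bound (T D : Finset ℕ)
    (hT : T ⊆ Finset.Icc 1 30) (hD : D ⊆ Finset.Icc 1 30)
    (hdisj : Disjoint T D) (hTcard : T.card = 2) (hDcard : D.card = 14)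
    (x y : ℕ) (hx : x ∈ D) (hy : y ∈ D) (hxy : x ≠ y) (hxy15 : x + y ≤ 15) :
    2 * (∑ v ∈ T, v) + (∑ v ∈ D, v) ≤ 403 ∧
      465 + 2 * (∑ v ∈ T, v) + (∑ v ∈ D, v) ≤ 868 := by
  have hy' : y ∈ D.erase x := Finset.mem_erase.2 ⟨hxy.symm, hy⟩
  set E := (D.erase x).erase y with hE
  have hED : E ⊆ D := (Finset.erase_subset _ _).trans (Finset.erase_subset _ _)
  have hEcard : E.card = 12 := by
    rw [hE, Finset.card_erase_of_mem hy', Finset.card_erase_of_mem hx, hDcard]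
  have hDsum : ∑ v ∈ D, v = x + (y + ∑ v ∈ E, v) := by
    rw [hE, Finset.add_sum_erase _ (fun v => v) hy', Finset.add_sum_erase _ (fun v => v) hx]
  have hTE : Disjoint T E := hdisj.mono_right hED
  have hTsum := Finset.sum_id_le_mul_card_add_sum_tsub hT 28
  have hTEsum :=
    Finset.sum_id_le_mul_card_add_sum_tsub (Finset.union_subset hT (hED.trans hD)) 16
  rw [Finset.sum_union hTE, Finset.card_union_of_disjoint hTE, hTcard, hEcard] at hTEsum
  rw [hTcard] at hTsum
  have h28 : ∑ v ∈ Finset.Icc 1 30, (v - 28) = 3 := by decide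
  have h16 : ∑ v ∈ Finset.Icc 1 30, (v - 16) = 105 := by decide
  omega
end

section
/- Let V be a finite type with 30 elements and f : V → ℕ a labeling that is a bijection onto {1, …, 30}. Let H : Fin 9 → Finset V be nine hexagons, each of cardinality 6 and each with label sum M. Fix i₀ : Fin 9 (the central hexagon) and for each vertex v let m(v) be the number of indices i ≠ i₀ with v ∈ H i; suppose exactly 2 vertices have m(v) = 3, exactly 14 vertices have m(v) = 2, and exactly 14 vertices have m(v) = 1. Suppose moreover there are four indices whose hexagons are pairwise disjoint, and two distinct vertices x, y lying outside the union of those four hexagons with m(x) = 2 and m(y) = 2. Then M ≠ 110. -/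
/-- Double counting of label sums over a family of finsets. -/
theorem sum_card_filter_mem_mul {V ι : Type*} [Fintype V] [DecidableEq V] (H : ι → Finset V)
    (t : Finset ι) (f : V → ℕ) :
    ∑ v, (t.filter fun i => v ∈ H i).card * f v = ∑ i ∈ t, ∑ v ∈ H i, f v := by
  simp_rw [Finset.card_filter, Finset.sum_mul, ite_mul, one_mul, zero_mul]
  rw [Finset.sum_comm]
  simp


/-- No 3 by 3 diamond-shaped HTP has magic constant 110. -/
theorem htp_diamond33_no_110 (V : Type*) [Fintype V] [DecidableEq V]
    (hcard : Fintype.card V = 30)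
    (f : V → ℕ) (hinj : Function.Injective f)
    (himg : Finset.image f Finset.univ = Finset.Icc 1 30)
    (H : Fin 9 → Finset V) (M : ℕ)
    (hhex : ∀ i, (H i).card = 6) (hsum : ∀ i, ∑ v ∈ H i, f v = M)
    (i₀ : Fin 9)
    (m : V → ℕ) (hm : ∀ v, m v = (Finset.univ.filter fun i => i ≠ i₀ ∧ v ∈ H i).card)
    (h3 : (Finset.univ.filter fun v => m v = 3).card = 2)
    (h2 : (Finset.univ.filter fun v => m v = 2).card = 14)
    (h1 : (Finset.univ.filter fun v => m v = 1).card = 14)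
    (s : Finset (Fin 9)) (hscard : s.card = 4)
    (hsdisj : ∀ i ∈ s, ∀ j ∈ s, i ≠ j → Disjoint (H i) (H j))
    (x y : V) (hxy : x ≠ y)
    (hxout : ∀ i ∈ s, x ∉ H i) (hyout : ∀ i ∈ s, y ∉ H i)
    (hmx : m x = 2) (hmy : m y = 2) :
    M ≠ 110 := by
  rintro rfl
  have hsumf (g : ℕ → ℕ) : ∑ v, g (f v) = ∑ k ∈ Finset.Icc 1 30, g k := by
    rw [← himg, Finset.sum_image hinj.injOn]
  have hf30 (v : V) : f v ≤ 30 :=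
    (Finset.mem_Icc.1 (himg ▸ Finset.mem_image_of_mem f (Finset.mem_univ v))).2
  have hm' (v : V) : m v = ((Finset.univ.erase i₀).filter fun i => v ∈ H i).card := by
    rw [hm]
    congr 1
    ext i
    simp
  have hmf : ∑ v, m v * f v = 880 := by
    simp_rw [hm', sum_card_filter_mem_mul, hsum]
    simp
  have hmsum : ∑ v, m v = 48 := by
    have := sum_card_filter_mem_mul H (Finset.univ.erase i₀) fun _ => 1
    simpa [hm', hhex] using this
  rw [Finset.card_filter] at h1 h2 h3
  have hm123 (v : V) : m v = 1 ∨ m v = 2 ∨ m v = 3 := by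
    have hle : ∀ v ∈ Finset.univ, ((if m v = 1 then 1 else 0) + (if m v = 2 then 1 else 0) +
        if m v = 3 then 1 else 0) ≤ 1 := by
      intro v _
      split_ifs <;> omega
    have heq := (Finset.sum_eq_sum_iff_of_le hle).1 (by
      simp only [Finset.sum_add_distrib, h1, h2, h3, Finset.sum_const, Finset.card_univ, hcard,
        smul_eq_mul]) v (Finset.mem_univ v)
    split_ifs at heq <;> omega
  have hfxy : f x + f y ≤ 25 := by
    have hunion : ∑ v ∈ s.biUnion H, f v = 440 := by
      rw [Finset.sum_biUnion hsdisj]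
      simp [hsum, hscard]
    have hdisj : Disjoint (s.biUnion H) {x, y} := by
      rw [Finset.disjoint_left]
      intro v hv hvxy
      obtain ⟨i, hi, hvi⟩ := Finset.mem_biUnion.1 hv
      rcases Finset.mem_insert.1 hvxy with rfl | hvy
      · exact hxout i hi hvi
      · exact hyout i hi (Finset.mem_singleton.1 hvy ▸ hvi)
    have hle := Finset.sum_le_univ_sum_of_nonneg (f := f) (s := s.biUnion H ∪ {x, y})
      fun _ => Nat.zero_le _
    rw [Finset.sum_union hdisj, hunion, Finset.sum_pair hxy] at hle
    have htotal : ∑ v, f v = 465 := hsumf id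
    omega
  -- `(m v - 1) (f v - 16) ≤ (f v - 16)⁺ + 14 [m v = 3]`, with the slack at `x` and `y` recorded
  have hpoint (v : V) : m v * f v + 16 + (if v ∈ ({x, y} : Finset V) then 16 - f v else 0) ≤
      f v + 16 * m v + (f v - 16) + 14 * if m v = 3 then 1 else 0 := by
    have hv := hf30 v
    split_ifs with hvxy hv3 hv3
    · rcases Finset.mem_insert.1 hvxy with rfl | hvy
      · omega
      · rw [Finset.mem_singleton.1 hvy] at hv3
        omega
    · have hv2 : m v = 2 := by
        rcases Finset.mem_insert.1 hvxy with rfl | hvy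
        · exact hmx
        · rwa [Finset.mem_singleton.1 hvy]
      rw [hv2]
      omega
    · rw [hv3]
      omega
    · rcases hm123 v with h | h | h <;> rw [h] <;> omega
  have hsumpoint := Finset.sum_le_sum fun v (_ : v ∈ Finset.univ) => hpoint v
  simp only [Finset.sum_add_distrib, ← Finset.mul_sum, hmf, hmsum, h3, Finset.sum_const,
    Finset.card_univ, hcard, Finset.sum_ite_mem, Finset.univ_inter, Finset.sum_pair hxy,
    smul_eq_mul] at hsumpoint
  have htotal : ∑ v, f v = 465 := hsumf id
  have hexcess : ∑ v, (f v - 16) = 105 := hsumf (· - 16)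
  omega
end

section
/- Let V be a finite type with 30 elements and f : V → ℕ a labeling that is a bijection onto {1, …, 30}. Let H : Fin 9 → Finset V be nine hexagons, each of cardinality 6 and each with label sum M. Fix i₀ : Fin 9 (the central hexagon) and for each vertex v let m(v) be the number of indices i ≠ i₀ with v ∈ H i; suppose exactly 2 vertices have m(v) = 3, exactly 14 vertices have m(v) = 2, and exactly 14 vertices have m(v) = 1. Suppose moreover there are four indices whose hexagons are pairwise disjoint, and two distinct vertices x, y lying outside the union of those four hexagons with m(x) = 2 and m(y) = 2. Then M ≠ 76. -/
/-- Pairwise distinct positive labels on `t` sum to at least `1 + ⋯ + #t`. -/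
theorem sum_range_card_succ_le_sum_of_injOn {V : Type*} [DecidableEq V] (t : Finset V)
    (g : V → ℕ) (hinj : Set.InjOn g t) (hpos : ∀ v ∈ t, 1 ≤ g v) :
    ∑ i ∈ Finset.range t.card, (i + 1) ≤ ∑ v ∈ t, g v := by
  induction h : t.card generalizing t with
  | zero => simp
  | succ n ih =>
    have hle : ∃ v ∈ t, n + 1 ≤ g v := by
      by_contra! hlt
      have hsub : t.image g ⊆ Finset.Icc 1 n := fun k hk => by
        obtain ⟨v, hv, rfl⟩ := Finset.mem_image.1 hk
        exact Finset.mem_Icc.2 ⟨hpos v hv, Nat.lt_succ_iff.1 (hlt v hv)⟩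
      have := Finset.card_le_card hsub
      rw [Finset.card_image_of_injOn hinj, Nat.card_Icc] at this
      omega
    obtain ⟨v, hv, hgv⟩ := hle
    have hrec := ih (t.erase v) (hinj.mono (by simp))
      (fun w hw => hpos w (Finset.mem_of_mem_erase hw)) (by simp [hv, h])
    rw [Finset.sum_range_succ, ← Finset.sum_erase_add _ _ hv]
    omega

/-- No 3 by 3 diamond-shaped HTP has magic constant 76. -/
theorem htp_diamond33_no_76 (V : Type*) [Fintype V] [DecidableEq V]
    (hcard : Fintype.card V = 30)
    (f : V → ℕ) (hinj : Function.Injective f)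
    (himg : Finset.image f Finset.univ = Finset.Icc 1 30)
    (H : Fin 9 → Finset V) (M : ℕ)
    (hhex : ∀ i, (H i).card = 6) (hsum : ∀ i, ∑ v ∈ H i, f v = M)
    (i₀ : Fin 9)
    (m : V → ℕ) (hm : ∀ v, m v = (Finset.univ.filter fun i => i ≠ i₀ ∧ v ∈ H i).card)
    (h3 : (Finset.univ.filter fun v => m v = 3).card = 2)
    (h2 : (Finset.univ.filter fun v => m v = 2).card = 14)
    (h1 : (Finset.univ.filter fun v => m v = 1).card = 14)
    (s : Finset (Fin 9)) (hscard : s.card = 4)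
    (hsdisj : ∀ i ∈ s, ∀ j ∈ s, i ≠ j → Disjoint (H i) (H j))
    (x y : V) (hxy : x ≠ y)
    (hxout : ∀ i ∈ s, x ∉ H i) (hyout : ∀ i ∈ s, y ∉ H i)
    (hmx : m x = 2) (hmy : m y = 2) :
    M ≠ 76 := by
  rintro rfl
  have hf : ∀ v, 1 ≤ f v ∧ f v ≤ 30 := fun v =>
    Finset.mem_Icc.1 (himg ▸ Finset.mem_image_of_mem f (Finset.mem_univ v))
  have htotal : ∑ v, f v = 465 := by
    rw [← Finset.sum_image (f := fun k => k) (hinj.injOn), himg]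
    decide
  -- every vertex lies on one, two or three of the non-central hexagons
  set A := Finset.univ.filter fun v => m v = 3
  set B := Finset.univ.filter fun v => m v = 2
  set C := Finset.univ.filter fun v => m v = 1
  have hAB : Disjoint A B := Finset.disjoint_filter.2 fun _ _ h => by omega
  have hABC : Disjoint (A ∪ B) C := by
    rw [Finset.disjoint_union_left]
    exact ⟨Finset.disjoint_filter.2 fun _ _ h => by omega,
      Finset.disjoint_filter.2 fun _ _ h => by omega⟩
  have hABcard : (A ∪ B).card = 16 := by rw [Finset.card_union_of_disjoint hAB, h3, h2]
  have huniv : A ∪ B ∪ C = Finset.univ := by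
    rw [← Finset.card_eq_iff_eq_univ, Finset.card_union_of_disjoint hABC, hABcard, h1, hcard]
  have hm1 : ∀ v, 1 ≤ m v := fun v => by
    have hv : v ∈ A ∪ B ∪ C := huniv ▸ Finset.mem_univ v
    simp only [A, B, C, Finset.mem_union, Finset.mem_filter, Finset.mem_univ, true_and] at hv
    omega
  -- double counting over the eight non-central hexagons
  have hweighted : ∑ v, m v * f v = 608 := by
    have hcount : ∀ v, m v * f v =
        ∑ i ∈ Finset.univ.erase i₀, if v ∈ H i then f v else 0 := fun v => by
      rw [← Finset.sum_filter, Finset.sum_const, smul_eq_mul, hm]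
      congr 2
      ext i
      simp
    simp_rw [hcount]
    rw [Finset.sum_comm]
    simp [hsum]
  have hrepeated : ∑ v, f v + ∑ v ∈ A ∪ B, f v ≤ ∑ v, m v * f v := by
    rw [← Finset.sum_filter_add_sum_filter_not Finset.univ (· ∈ A ∪ B) fun v => m v * f v,
      ← Finset.sum_filter_add_sum_filter_not Finset.univ (· ∈ A ∪ B) f]
    have hon : ∑ v ∈ A ∪ B, 2 * f v ≤ ∑ v ∈ A ∪ B, m v * f v :=
      Finset.sum_le_sum fun v hv => Nat.mul_le_mul_right _ (by
        simp only [A, B, Finset.mem_union, Finset.mem_filter, Finset.mem_univ, true_and] at hv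
        omega)
    have hoff : ∑ v ∈ Finset.univ.filter (· ∉ A ∪ B), f v ≤
        ∑ v ∈ Finset.univ.filter (· ∉ A ∪ B), m v * f v :=
      Finset.sum_le_sum fun v _ => Nat.le_mul_of_pos_left _ (hm1 v)
    rw [← Finset.mul_sum] at hon
    rw [Finset.filter_univ_mem]
    omega
  have hpair_card : ({x, y} : Finset V).card = 2 := Finset.card_pair hxy
  have hpair_sum : ∑ v ∈ ({x, y} : Finset V), f v = f x + f y := Finset.sum_pair hxy
  have hrest : 105 + (f x + f y) ≤ ∑ v ∈ A ∪ B, f v := by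
    have hsub : ({x, y} : Finset V) ⊆ A ∪ B := by
      simp [Finset.insert_subset_iff, A, B, hmx, hmy]
    have hlow := sum_range_card_succ_le_sum_of_injOn ((A ∪ B) \ {x, y}) f hinj.injOn
      fun v _ => (hf v).1
    rw [Finset.card_sdiff_of_subset hsub, hABcard, hpair_card] at hlow
    have hsplit := Finset.sum_sdiff (f := f) hsub
    simp only [Nat.reduceSub, Finset.sum_range_succ, Finset.sum_range_zero] at hlow
    omega
  -- the six vertices missed by the four disjoint hexagons
  set U := s.biUnion H
  have hUcard : Uᶜ.card = 6 := by
    rw [Finset.card_compl, Finset.card_biUnion hsdisj, Finset.sum_congr rfl fun i _ => hhex i,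
      Finset.sum_const, hscard, hcard]
    rfl
  have hUsum : ∑ v ∈ U, f v = 304 := by
    rw [Finset.sum_biUnion hsdisj, Finset.sum_congr rfl fun i _ => hsum i, Finset.sum_const,
      hscard]
    rfl
  have hlarge : 47 ≤ f x + f y := by
    have hsub : ({x, y} : Finset V) ⊆ Uᶜ := by
      simpa [Finset.insert_subset_iff, U] using And.intro hxout hyout
    have hcard4 : (Uᶜ \ {x, y}).card = 4 := by
      rw [Finset.card_sdiff_of_subset hsub, hUcard, hpair_card]
    have hlow := sum_range_card_succ_le_sum_of_injOn (Uᶜ \ {x, y}) (fun v => 31 - f v)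
      (fun v _ w _ h => hinj (by have := hf v; have := hf w; dsimp only at h; omega))
      fun v _ => by have := hf v; omega
    have hflip : ∑ v ∈ Uᶜ \ {x, y}, (31 - f v) + ∑ v ∈ Uᶜ \ {x, y}, f v = 4 * 31 := by
      rw [← Finset.sum_add_distrib, ← hcard4, ← smul_eq_mul, ← Finset.sum_const]
      exact Finset.sum_congr rfl fun v _ => by have := hf v; omega
    rw [hcard4] at hlow
    have hsplit := Finset.sum_sdiff (f := f) hsub
    have hcompl := Finset.sum_add_sum_compl U f
    simp only [Finset.sum_range_succ, Finset.sum_range_zero] at hlow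
    omega
  omega
end

section
/- Let V be a finite type with 13 elements and f : V → ℕ a labeling that is a bijection onto {1, …, 13}. Let H : Fin 3 → Finset V be three hexagons, each of cardinality 6 and each with label sum M. For each vertex v let m(v) be the number of indices i with v ∈ H i, and suppose exactly 1 vertex has m(v) = 3, exactly 3 vertices have m(v) = 2, and exactly 9 vertices have m(v) = 1. Then 34 ≤ M ≤ 50. -/
/-- Summing the sums over a finite family of sets counts each element with the number of
sets that contain it. -/
theorem sum_sum_mem_eq_sum_card_mul {ι V : Type*} [Fintype ι] [Fintype V] [DecidableEq V]
    (H : ι → Finset V) (f : V → ℕ) :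
    ∑ i, ∑ v ∈ H i, f v = ∑ v, (Finset.univ.filter fun i => v ∈ H i).card * f v := by
  have h : ∀ i, ∑ v ∈ H i, f v = ∑ v, if v ∈ H i then f v else 0 := fun i => by
    rw [← Finset.sum_filter, Finset.filter_mem_eq_inter, Finset.univ_inter]
  simp_rw [h]
  rw [Finset.sum_comm]
  refine Finset.sum_congr rfl fun v _ => ?_
  rw [← Finset.sum_filter, Finset.sum_const, smul_eq_mul]


/-- The magic constant of a 2 by 2 triangular-shaped HTP on 13 vertices lies
between 34 and 50. -/
theorem htp_triangle22_magic_bound (V : Type*) [Fintype V] [DecidableEq V]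
    (hcard : Fintype.card V = 13)
    (f : V → ℕ) (hinj : Function.Injective f)
    (himg : Finset.image f Finset.univ = Finset.Icc 1 13)
    (H : Fin 3 → Finset V) (M : ℕ)
    (hhex : ∀ i, (H i).card = 6) (hsum : ∀ i, ∑ v ∈ H i, f v = M)
    (m : V → ℕ) (hm : ∀ v, m v = (Finset.univ.filter fun i => v ∈ H i).card)
    (h3 : (Finset.univ.filter fun v => m v = 3).card = 1)
    (h2 : (Finset.univ.filter fun v => m v = 2).card = 3)
    (h1 : (Finset.univ.filter fun v => m v = 1).card = 9) :
    34 ≤ M ∧ M ≤ 50 := by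
  have hm_le : ∀ v, m v ≤ 3 := fun v => by
    rw [hm]
    exact (Finset.card_le_univ _).trans (by simp)
  have hm_ne : ∀ v, m v ≠ 0 := by
    have hfib := Finset.card_eq_sum_card_fiberwise (f := m) (s := Finset.univ)
      (t := Finset.range 4) (fun v _ => by simpa using Nat.lt_succ_of_le (hm_le v))
    rw [Finset.card_univ, hcard] at hfib
    simp only [Finset.sum_range_succ, Finset.sum_range_zero, h1, h2, h3] at hfib
    have h0 : (Finset.univ.filter fun v => m v = 0).card = 0 := by omega
    rw [Finset.card_eq_zero, Finset.filter_eq_empty_iff] at h0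
    exact fun v => h0 (Finset.mem_univ v)
  have hf : ∀ v, 1 ≤ f v ∧ f v ≤ 13 := fun v => by
    rw [← Finset.mem_Icc, ← himg]
    exact Finset.mem_image_of_mem f (Finset.mem_univ v)
  have htotal : ∑ v, f v = 91 := by
    have h := Finset.sum_image (f := fun n : ℕ => n) (s := Finset.univ) hinj.injOn
    rw [himg] at h
    rw [← h]
    decide
  have hsplit : 3 * M = ∑ v, f v + ∑ v ∈ Finset.univ.filter (fun v => m v = 2), f v
      + 2 * ∑ v ∈ Finset.univ.filter (fun v => m v = 3), f v := by
    have h := sum_sum_mem_eq_sum_card_mul H f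
    simp only [hsum, ← hm, Finset.sum_const, Finset.card_univ, Fintype.card_fin,
      smul_eq_mul] at h
    rw [h, Finset.sum_filter, Finset.sum_filter, Finset.mul_sum, ← Finset.sum_add_distrib,
      ← Finset.sum_add_distrib]
    refine Finset.sum_congr rfl fun v _ => ?_
    have hle := hm_le v
    have hne := hm_ne v
    obtain h | h | h : m v = 1 ∨ m v = 2 ∨ m v = 3 := by omega
    all_goals
      simp [h]
      try ring
  obtain ⟨c, hc⟩ := Finset.card_eq_one.mp h3
  obtain ⟨x, y, z, hxy, hxz, hyz, hs⟩ := Finset.card_eq_three.mp h2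
  have hmc : m c = 3 := by
    have h : c ∈ Finset.univ.filter (fun v => m v = 3) := by simp [hc]
    simpa using h
  have hm2 : ∀ v ∈ ({x, y, z} : Finset V), f v ≠ f c := fun v hv he => by
    rw [← hs, Finset.mem_filter, hinj he] at hv
    omega
  rw [htotal, hs, hc, Finset.sum_singleton, Finset.sum_insert (by simp [hxy, hxz]),
    Finset.sum_pair hyz] at hsplit
  have hxc := hm2 x (by simp)
  have hyc := hm2 y (by simp)
  have hzc := hm2 z (by simp)
  have hxy' := hinj.ne hxy
  have hxz' := hinj.ne hxz
  have hyz' := hinj.ne hyz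
  have hx := hf x
  have hy := hf y
  have hz := hf z
  have hc' := hf c
  omega
end

section
/- Let b, c, d be pairwise disjoint subsets of {1, …, 33} with |b| = 6, |c| = 3, and |d| = 6, and let M be a natural number satisfying 12·M + (∑_{x ∈ b} x) = 2·(∑_{x ∈ c} x) + (∑_{x ∈ d} x) + 1122. Then 83 ≤ M ≤ 121. -/
/-- Distinct naturals that are at least `a` sum to at least `a + (a + 1) + ⋯`. -/
lemma Finset.sum_range_add_le_sum_of_forall_le {s : Finset ℕ} {a : ℕ} (hs : ∀ x ∈ s, a ≤ x) :
    ∑ n ∈ Finset.range s.card, (a + n) ≤ ∑ x ∈ s, x := by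
  have h := Finset.sum_range_le_sum (s := s.map Nat.castEmbedding) (c := (a : ℤ))
    (by simpa using hs)
  zify
  simpa only [Finset.card_map, Finset.sum_map, Nat.castEmbedding_apply] using h

/-- Distinct naturals that are at most `a` sum to at most `a + (a - 1) + ⋯`, over the integers. -/
lemma Finset.sum_le_sum_range_sub_of_forall_le {s : Finset ℕ} {a : ℕ} (hs : ∀ x ∈ s, x ≤ a) :
    ((∑ x ∈ s, x : ℕ) : ℤ) ≤ ∑ n ∈ Finset.range s.card, ((a : ℤ) - n) := by
  have h := Finset.sum_le_sum_range (s := s.map Nat.castEmbedding) (c := (a : ℤ))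
    (by simpa using hs)
  simpa only [Finset.card_map, Finset.sum_map, Nat.castEmbedding_apply, Nat.cast_sum] using h

/-- Arithmetic bound for the 4 by 4 triangular-shaped HTP: if `b, c, d` are
pairwise disjoint subsets of `{1, …, 33}` with `|b| = 6`, `|c| = 3`, `|d| = 6`,
and `12M + (∑ b) = 2·(∑ c) + (∑ d) + 1122`, then `83 ≤ M ≤ 121`. -/
theorem htp_triangle44_bound (b c d : Finset ℕ) (M : ℕ)
    (hb : b ⊆ Finset.Icc 1 33) (hc : c ⊆ Finset.Icc 1 33) (hd : d ⊆ Finset.Icc 1 33)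
    (hbc : Disjoint b c) (hbd : Disjoint b d) (hcd : Disjoint c d)
    (hbcard : b.card = 6) (hccard : c.card = 3) (hdcard : d.card = 6)
    (hM : 12 * M + (∑ x ∈ b, x) = 2 * (∑ x ∈ c, x) + (∑ x ∈ d, x) + 1122) :
    83 ≤ M ∧ M ≤ 121 := by
  have lower {s : Finset ℕ} (hs : s ⊆ Finset.Icc 1 33) :=
    Finset.sum_range_add_le_sum_of_forall_le fun x hx ↦ (Finset.mem_Icc.mp (hs hx)).1
  have upper {s : Finset ℕ} (hs : s ⊆ Finset.Icc 1 33) :=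
    Finset.sum_le_sum_range_sub_of_forall_le fun x hx ↦ (Finset.mem_Icc.mp (hs hx)).2
  have hcd_card : (c ∪ d).card = 9 := by rw [Finset.card_union_of_disjoint hcd, hccard, hdcard]
  have hcd_sum : ∑ x ∈ c ∪ d, x = ∑ x ∈ c, x + ∑ x ∈ d, x := Finset.sum_union hcd
  have lb := lower hb
  have ub := upper hb
  have lc := lower hc
  have uc := upper hc
  have lcd := lower (Finset.union_subset hc hd)
  have ucd := upper (Finset.union_subset hc hd)
  rw [hbcard] at lb ub
  rw [hccard] at lc uc
  rw [hcd_card, hcd_sum] at lcd ucd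
  simp only [Finset.sum_range_succ, Finset.sum_range_zero] at lb ub lc uc lcd ucd
  omega
end

section
/- Let V be a finite type with 24 elements and f : V → ℕ a labeling that is a bijection onto {1, …, 24}. Let H : Fin 7 → Finset V be seven hexagons, each of cardinality 6 and each with label sum M. Fix i₀ : Fin 7 (the central hexagon) and for each vertex v let m(v) be the number of indices i ≠ i₀ with v ∈ H i; suppose every vertex of H i₀ has m(v) = 2, exactly 12 vertices in total have m(v) = 2, and the remaining 12 vertices have m(v) = 1. Then 65 ≤ M ≤ 85. -/
/-- Six distinct labels from `{1, …, 24}` sum to at least `1 + ⋯ + 6`. -/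
lemma le_sum_of_card_eq_six {s : Finset ℕ} (hs : s ⊆ Finset.Icc 1 24) (hc : s.card = 6) :
    21 ≤ ∑ x ∈ s, x := by
  have hdef : ∑ x ∈ s, (6 - x) ≤ ∑ x ∈ Finset.Icc 1 24, (6 - x) :=
    Finset.sum_le_sum_of_subset hs
  have htot : ∑ x ∈ Finset.Icc 1 24, (6 - x) = 15 := by decide
  have hle : s.card • 6 ≤ ∑ x ∈ s, (x + (6 - x)) :=
    Finset.card_nsmul_le_sum _ _ _ fun x _ => by omega
  rw [Finset.sum_add_distrib, hc, smul_eq_mul] at hle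
  omega

/-- Six distinct labels from `{1, …, 24}` sum to at most `19 + ⋯ + 24`. -/
lemma sum_le_of_card_eq_six {s : Finset ℕ} (hs : s ⊆ Finset.Icc 1 24) (hc : s.card = 6) :
    ∑ x ∈ s, x ≤ 129 := by
  have hexc : ∑ x ∈ s, (x - 19) ≤ ∑ x ∈ Finset.Icc 1 24, (x - 19) :=
    Finset.sum_le_sum_of_subset hs
  have htot : ∑ x ∈ Finset.Icc 1 24, (x - 19) = 15 := by decide
  have hle : ∑ x ∈ s, x ≤ ∑ x ∈ s, (19 + (x - 19)) :=
    Finset.sum_le_sum fun x _ => by omega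
  rw [Finset.sum_add_distrib, Finset.sum_const, hc, smul_eq_mul] at hle
  omega

/-- Double counting: summing the sums of `f` over the sets `H i`, for the indices `i` satisfying
`p`, weights each point by the number of these sets that contain it. -/
lemma sum_sum_eq_sum_card_mul {ι V : Type*} [Fintype ι] [Fintype V] [DecidableEq V]
    (p : ι → Prop) [DecidablePred p] (H : ι → Finset V) (f : V → ℕ) :
    ∑ i with p i, ∑ v ∈ H i, f v = ∑ v, (Finset.univ.filter fun i => p i ∧ v ∈ H i).card * f v := by
  rw [Finset.sum_comm' (t' := Finset.univ) (s' := fun v => Finset.univ.filter fun i => p i ∧ v ∈ H i)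
    (by simp)]
  simp


/-- The magic constant of a 2 by 2 hexagonal-shaped HTP on 24 vertices lies
between 65 and 85. -/
theorem htp_hexagonal22_magic_bound (V : Type*) [Fintype V] [DecidableEq V]
    (hcard : Fintype.card V = 24)
    (f : V → ℕ) (hinj : Function.Injective f)
    (himg : Finset.image f Finset.univ = Finset.Icc 1 24)
    (H : Fin 7 → Finset V) (M : ℕ)
    (hhex : ∀ i, (H i).card = 6) (hsum : ∀ i, ∑ v ∈ H i, f v = M)
    (i₀ : Fin 7)
    (m : V → ℕ) (hm : ∀ v, m v = (Finset.univ.filter fun i => i ≠ i₀ ∧ v ∈ H i).card)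
    (hcen : ∀ v ∈ H i₀, m v = 2)
    (h2 : (Finset.univ.filter fun v => m v = 2).card = 12)
    (h1 : (Finset.univ.filter fun v => m v = 1).card = 12) :
    65 ≤ M ∧ M ≤ 85 := by
  have hm12 : ∀ v, m v = 2 ∨ m v = 1 := by
    have hdisj : Disjoint (Finset.univ.filter fun v => m v = 2)
        (Finset.univ.filter fun v => m v = 1) :=
      Finset.disjoint_filter.2 fun v _ h => by omega
    have huniv := Finset.eq_univ_of_card _
      ((Finset.card_union_of_disjoint hdisj).trans (by omega))
    intro v
    simpa only [Finset.mem_union, Finset.mem_filter_univ] using huniv.ge (Finset.mem_univ v)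
  have hsub : H i₀ ⊆ Finset.univ.filter fun v => m v = 2 := fun v hv => by simp [hcen v hv]
  set b := (Finset.univ.filter fun v => m v = 2) \ H i₀ with hb
  have hbcard : (b.image f).card = 6 := by
    rw [Finset.card_image_of_injective _ hinj, hb, Finset.card_sdiff_of_subset hsub, h2, hhex]
  have hbsub : b.image f ⊆ Finset.Icc 1 24 := himg ▸ Finset.image_subset_image b.subset_univ
  have hbsum : ∑ x ∈ b.image f, x = ∑ v ∈ b, f v := Finset.sum_image hinj.injOn
  have hlower := le_sum_of_card_eq_six hbsub hbcard
  have hupper := sum_le_of_card_eq_six hbsub hbcard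
  have htotal : ∑ v, f v = 300 := by
    rw [← Finset.sum_image (f := fun x => x) hinj.injOn, himg]
    decide
  have hsplit : ∑ v ∈ b, f v + M = ∑ v with m v = 2, f v := by
    rw [← hsum i₀, Finset.sum_sdiff hsub]
  have hweight : ∑ v, m v * f v = ∑ v, f v + ∑ v with m v = 2, f v := by
    rw [Finset.sum_filter, ← Finset.sum_add_distrib]
    refine Finset.sum_congr rfl fun v _ => ?_
    rcases hm12 v with h | h <;> simp [h, two_mul]
  have hcount : 6 * M = ∑ v, m v * f v := by
    simp_rw [hm, ← sum_sum_eq_sum_card_mul, hsum]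
    simp [Finset.filter_ne']
  omega
end

section
/- Let V be a finite type with 54 elements and f : V → ℕ a labeling that is a bijection onto {1, …, 54}. Suppose there exist two families, each consisting of seven pairwise disjoint subsets of V of cardinality 6 each with label sum M, such that the complement of the union of the first family and the complement of the union of the second family are disjoint subsets of V. Then 140 ≤ M ≤ 190. -/
/-- Distinct positive labels on `S` sum to at least `1 + 2 + ⋯ + #S`. -/
theorem sum_range_card_succ_le_sum_of_injective {V : Type*} {f : V → ℕ}
    (hinj : Function.Injective f) (hpos : ∀ v, 0 < f v) (S : Finset V) :
    ∑ i ∈ Finset.range (S.card + 1), i ≤ ∑ v ∈ S, f v := by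
  have hcast : Function.Injective fun v => (f v : ℤ) := Nat.cast_injective.comp hinj
  have h := Finset.sum_range_le_sum (s := S.image fun v => (f v : ℤ)) (c := 1)
    (by simpa using fun v _ => by exact_mod_cast hpos v)
  rw [Finset.sum_image hcast.injOn, Finset.card_image_of_injective S hcast] at h
  rw [Finset.sum_range_succ']
  zify
  simpa [add_comm] using h

/-- Seven disjoint hexagons with common sum `M` leave out vertices whose number and label sum
are determined. -/
theorem card_sdiff_biUnion_and_sum {V : Type*} [Fintype V] [DecidableEq V] (f : V → ℕ)
    {n k : ℕ} (A : Fin n → Finset V) (M : ℕ) (hcard : ∀ i, (A i).card = k)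
    (hdisj : ∀ i j, i ≠ j → Disjoint (A i) (A j)) (hsum : ∀ i, ∑ v ∈ A i, f v = M) :
    (Finset.univ \ Finset.univ.biUnion A).card + n * k = Fintype.card V ∧
      ∑ v ∈ Finset.univ \ Finset.univ.biUnion A, f v + n * M = ∑ v, f v := by
  have hpair : Set.PairwiseDisjoint (↑(Finset.univ : Finset (Fin n))) A :=
    fun i _ j _ hij => hdisj i j hij
  constructor
  · rw [← Finset.card_univ, ← Finset.card_sdiff_add_card_eq_card
      (Finset.subset_univ (Finset.univ.biUnion A)), Finset.card_biUnion hpair]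
    simp [hcard]
  · rw [← Finset.sum_sdiff (Finset.subset_univ (Finset.univ.biUnion A)),
      Finset.sum_biUnion hpair]
    simp [hsum]


/-- The magic constant of a 3 by 3 hexagonal-shaped HTP on 54 vertices lies
between 140 and 190. -/
theorem htp_hexagonal33_magic_bound (V : Type*) [Fintype V] [DecidableEq V]
    (hcard : Fintype.card V = 54)
    (f : V → ℕ) (hinj : Function.Injective f)
    (himg : Finset.image f Finset.univ = Finset.Icc 1 54)
    (A B : Fin 7 → Finset V) (M : ℕ)
    (hAcard : ∀ i, (A i).card = 6) (hBcard : ∀ i, (B i).card = 6)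
    (hAdisj : ∀ i j, i ≠ j → Disjoint (A i) (A j))
    (hBdisj : ∀ i j, i ≠ j → Disjoint (B i) (B j))
    (hAsum : ∀ i, ∑ v ∈ A i, f v = M) (hBsum : ∀ i, ∑ v ∈ B i, f v = M)
    (hcompl : Disjoint (Finset.univ \ Finset.univ.biUnion A)
      (Finset.univ \ Finset.univ.biUnion B)) :
    140 ≤ M ∧ M ≤ 190 := by
  have hpos : ∀ v, 0 < f v := fun v =>
    (Finset.mem_Icc.mp (himg ▸ Finset.mem_image_of_mem f (Finset.mem_univ v))).1
  have htotal : ∑ v, f v = 1485 := by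
    have h : ∑ i ∈ Finset.univ.image f, i = ∑ v, f v := Finset.sum_image hinj.injOn
    rw [← h, himg]
    decide
  obtain ⟨hcA, hsA⟩ := card_sdiff_biUnion_and_sum f A M hAcard hAdisj hAsum
  obtain ⟨hcB, hsB⟩ := card_sdiff_biUnion_and_sum f B M hBcard hBdisj hBsum
  set C := Finset.univ \ Finset.univ.biUnion A
  set D := Finset.univ \ Finset.univ.biUnion B
  have hcard_union : (C ∪ D).card = 24 := by
    rw [Finset.card_union_of_disjoint hcompl]
    omega
  have hsum_union : ∑ v ∈ C ∪ D, f v = ∑ v ∈ C, f v + ∑ v ∈ D, f v :=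
    Finset.sum_union hcompl
  have hcard_compl : (C ∪ D)ᶜ.card = 30 := by
    rw [Finset.card_compl, hcard, hcard_union]
  have hsum_compl := Finset.sum_add_sum_compl (C ∪ D) f
  have hlow := sum_range_card_succ_le_sum_of_injective hinj hpos (C ∪ D)
  have hhigh := sum_range_card_succ_le_sum_of_injective hinj hpos (C ∪ D)ᶜ
  rw [hcard_union, Finset.sum_range_id] at hlow
  rw [hcard_compl, Finset.sum_range_id] at hhigh
  omega
end
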